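/- Let δ = 2^{-14}, let α ∈ (0,1), let n be a natural number, and let I be an interval contained in (2^{31}·(α n)^{-1}, π] with length |I| = δ/n. Let g be a {0,1}-cosine polynomial with deg(g) ≤ n^{1−α} and set f = D_n − g. Then f has at most 2·α^{-1} roots in I. -/

import Mathlib

open Real MeasureTheory

/-- `zeros f S` : the number of zeros of `f` in the set `S`. -/
noncomputable def zeros (f : ℝ → ℝ) (S : Set ℝ) : ℕ := {x ∈ S | f x = 0}.ncard

/-- The Dirichlet-type kernel `D_n(x) = ∑_{k=0}^n cos (k x)`. -/
noncomputable def Dker (n : ℕ) : ℝ → ℝ := fun x => ∑ k ∈ Finset.range (n + 1), Real.cos (k * x)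

/-- Iterated Rolle: between `m + 1` zeros of `f` there are `m` zeros of its derivative. -/
lemma exists_finset_zeros_deriv {f f' : ℝ → ℝ} (hf : ∀ x, HasDerivAt f (f' x) x) {a b : ℝ} {m : ℕ}
    (S : Finset ℝ) (hS : S.card = m + 1) (hSz : ∀ x ∈ S, x ∈ Set.Icc a b ∧ f x = 0) :
    ∃ T : Finset ℝ, T.card = m ∧ ∀ x ∈ T, x ∈ Set.Icc a b ∧ f' x = 0 := by
  set s := S.orderEmbOfFin hS
  have hs : ∀ i, s i ∈ Set.Icc a b ∧ f (s i) = 0 :=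
    fun i => hSz _ (S.orderEmbOfFin_mem hS i)
  have hrolle : ∀ i : Fin m, ∃ c ∈ Set.Ioo (s i.castSucc) (s i.succ), f' c = 0 := fun i =>
    exists_hasDerivAt_eq_zero (s.strictMono i.castSucc_lt_succ)
      (fun x _ => (hf x).continuousAt.continuousWithinAt)
      ((hs _).2.trans (hs _).2.symm) (fun x _ => hf x)
  choose t ht ht' using hrolle
  have hmono : StrictMono t := fun i j hij =>
    ((ht i).2.trans_le (s.monotone (Fin.succ_le_castSucc_iff.2 hij))).trans (ht j).1
  refine ⟨Finset.univ.map ⟨t, hmono.injective⟩, by simp, fun x hx => ?_⟩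
  obtain ⟨i, -, rfl⟩ := Finset.mem_map.1 hx
  exact ⟨⟨(hs _).1.1.trans (ht i).1.le, (ht i).2.le.trans (hs _).1.2⟩, ht' i⟩

/-- A function with `k + 1` zeros in an interval has a zero of its `k`-th derivative there. -/
lemma exists_zero_of_card_zeros {G : ℕ → ℝ → ℝ} (hG : ∀ k x, HasDerivAt (G k) (G (k + 1) x) x)
    {a b : ℝ} {k : ℕ} (S : Finset ℝ) (hS : S.card = k + 1)
    (hSz : ∀ x ∈ S, x ∈ Set.Icc a b ∧ G 0 x = 0) : ∃ x ∈ Set.Icc a b, G k x = 0 := by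
  induction k generalizing G S with
  | zero =>
    obtain ⟨x, hx⟩ := Finset.card_pos.1 (by omega : 0 < S.card)
    exact ⟨x, hSz x hx⟩
  | succ k ih =>
    obtain ⟨T, hT, hTz⟩ := exists_finset_zeros_deriv (hG 0) S hS hSz
    exact ih (G := fun i => G (i + 1)) (fun i => hG (i + 1)) T hT hTz

/-- The `k`-th derivative of `x ↦ sin (w x)`. -/
noncomputable def sinDeriv (w : ℝ) (k : ℕ) (x : ℝ) : ℝ := w ^ k * Real.sin (w * x + k * (π / 2))

lemma hasDerivAt_sinDeriv (w : ℝ) (k : ℕ) (x : ℝ) :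
    HasDerivAt (sinDeriv w k) (sinDeriv w (k + 1) x) x := by
  have h : HasDerivAt (fun y => w * y + k * (π / 2)) w x := by
    simpa using ((hasDerivAt_id x).const_mul w).add_const (k * (π / 2))
  have hc : Real.cos (w * x + k * (π / 2)) = Real.sin (w * x + (k + 1 : ℕ) * (π / 2)) := by
    rw [← Real.sin_add_pi_div_two]; push_cast; ring_nf
  refine (h.sin.const_mul (w ^ k)).congr_deriv ?_
  rw [hc, sinDeriv]
  ring

lemma abs_sinDeriv_le {w W : ℝ} (hw : |w| ≤ W) (k : ℕ) (x : ℝ) : |sinDeriv w k x| ≤ W ^ k := by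
  rw [sinDeriv, abs_mul, abs_pow]
  calc |w| ^ k * |Real.sin (w * x + k * (π / 2))| ≤ |w| ^ k * 1 := by
        gcongr; exact Real.abs_sin_le_one _
    _ ≤ W ^ k := by rw [mul_one]; gcongr

lemma two_mul_sin_half_mul_cos (j : ℕ) (x : ℝ) :
    2 * Real.sin (x / 2) * Real.cos (j * x) =
      sinDeriv (j + 1 / 2) 0 x - sinDeriv (j - 1 / 2) 0 x := by
  have h1 : ((j : ℝ) + 1 / 2) * x = j * x + x / 2 := by ring
  have h2 : ((j : ℝ) - 1 / 2) * x = j * x - x / 2 := by ring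
  simp only [sinDeriv, pow_zero, one_mul, Nat.cast_zero, zero_mul, add_zero, h1, h2,
    Real.sin_add, Real.sin_sub]
  ring

lemma two_mul_sin_half_mul_Dker (n : ℕ) (x : ℝ) :
    2 * Real.sin (x / 2) * Dker n x = sinDeriv (n + 1 / 2) 0 x + sinDeriv (1 / 2) 0 x := by
  have h0 : sinDeriv (-(1 / 2)) 0 x = -sinDeriv (1 / 2) 0 x := by simp [sinDeriv]
  simp only [Dker, Finset.mul_sum, two_mul_sin_half_mul_cos]
  induction n with
  | zero =>
    simp only [zero_add, Finset.sum_range_one, Nat.cast_zero, zero_sub, h0, sub_neg_eq_add]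
  | succ n ih =>
    rw [Finset.sum_range_succ, ih]
    push_cast
    rw [show (n : ℝ) + 1 - 1 / 2 = n + 1 / 2 by ring]
    ring

/-- The `k`-th derivative of `2 sin (x / 2) g(x)`, where `g = ∑_{j ≤ n} ε_j cos (j x)`. -/
noncomputable def cosPolyDeriv (n : ℕ) (ε : ℕ → ℝ) (k : ℕ) (x : ℝ) : ℝ :=
  ∑ j ∈ Finset.range (n + 1), ε j * (sinDeriv (j + 1 / 2) k x - sinDeriv (j - 1 / 2) k x)

lemma hasDerivAt_cosPolyDeriv (n : ℕ) (ε : ℕ → ℝ) (k : ℕ) (x : ℝ) :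
    HasDerivAt (cosPolyDeriv n ε k) (cosPolyDeriv n ε (k + 1) x) x :=
  HasDerivAt.fun_sum fun j _ =>
    ((hasDerivAt_sinDeriv _ k x).sub (hasDerivAt_sinDeriv _ k x)).const_mul (ε j)

lemma abs_cosPolyDeriv_le (n : ℕ) {ε : ℕ → ℝ} (hε : ∀ k, ε k = 0 ∨ ε k = 1) {M : ℝ} (hM : 0 ≤ M)
    (hdeg : ∀ k : ℕ, M < k → ε k = 0) (k : ℕ) (x : ℝ) :
    |cosPolyDeriv n ε k x| ≤ (M + 1) * (2 * (M + 1 / 2) ^ k) := by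
  have hterm : ∀ j ∈ Finset.range (⌊M⌋₊ + 1),
      |ε j * (sinDeriv (j + 1 / 2) k x - sinDeriv (j - 1 / 2) k x)| ≤ 2 * (M + 1 / 2) ^ k := by
    intro j hj
    have hjM : (j : ℝ) ≤ M := (Nat.le_floor_iff hM).1 (by simpa [Nat.lt_succ_iff] using hj)
    have hj0 : (0 : ℝ) ≤ j := j.cast_nonneg
    have h1 := abs_sinDeriv_le (w := j + 1 / 2) (W := M + 1 / 2)
      (abs_le.2 ⟨by linarith, by linarith⟩) k x
    have h2 := abs_sinDeriv_le (w := j - 1 / 2) (W := M + 1 / 2)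
      (abs_le.2 ⟨by linarith, by linarith⟩) k x
    have h3 := abs_sub (sinDeriv (j + 1 / 2) k x) (sinDeriv (j - 1 / 2) k x)
    rcases hε j with h | h
    · rw [h, zero_mul, abs_zero]; positivity
    · rw [h, one_mul]; linarith
  have hsub : (Finset.range (n + 1)).filter (fun j => ε j ≠ 0) ⊆ Finset.range (⌊M⌋₊ + 1) := by
    intro j hj
    have hj := (Finset.mem_filter.1 hj).2
    have : (j : ℝ) ≤ M := not_lt.1 fun h => hj (hdeg j h)
    exact Finset.mem_range.2 (Nat.lt_succ_of_le (Nat.le_floor this))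
  calc |cosPolyDeriv n ε k x|
      ≤ ∑ j ∈ Finset.range (n + 1),
          |ε j * (sinDeriv (j + 1 / 2) k x - sinDeriv (j - 1 / 2) k x)| :=
        Finset.abs_sum_le_sum_abs _ _
    _ = ∑ j ∈ (Finset.range (n + 1)).filter (fun j => ε j ≠ 0),
          |ε j * (sinDeriv (j + 1 / 2) k x - sinDeriv (j - 1 / 2) k x)| := by
        symm
        apply Finset.sum_filter_of_ne
        intro j _ h h0
        rw [h0, zero_mul, abs_zero] at h
        exact h rfl
    _ ≤ ∑ j ∈ Finset.range (⌊M⌋₊ + 1),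
          |ε j * (sinDeriv (j + 1 / 2) k x - sinDeriv (j - 1 / 2) k x)| :=
        Finset.sum_le_sum_of_subset_of_nonneg hsub fun _ _ _ => abs_nonneg _
    _ ≤ (⌊M⌋₊ + 1 : ℕ) * (2 * (M + 1 / 2) ^ k) := by
        simpa using Finset.sum_le_sum hterm
    _ ≤ (M + 1) * (2 * (M + 1 / 2) ^ k) := by
        push_cast
        gcongr
        exact Nat.floor_le hM

lemma add_half_pow_le {M : ℝ} (hM : 1 ≤ M) {k : ℕ} (hk : (k : ℝ) ≤ 4 * M) :
    (M + 1 / 2) ^ k ≤ 8 * M ^ k := by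
  have hM0 : 0 < M := by linarith
  have h2 : Real.exp 2 ≤ 8 := by
    have h := Real.exp_one_lt_d9
    have h' : Real.exp 2 = Real.exp 1 * Real.exp 1 := by rw [← Real.exp_add]; norm_num
    nlinarith [Real.exp_pos 1]
  calc (M + 1 / 2) ^ k = (1 / (2 * M) + 1) ^ k * M ^ k := by
        rw [← mul_pow]; congr 1; field_simp; ring
    _ ≤ Real.exp (1 / (2 * M)) ^ k * M ^ k := by
        gcongr; exact Real.add_one_le_exp _
    _ = Real.exp (k * (1 / (2 * M))) * M ^ k := by rw [Real.exp_nat_mul]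
    _ ≤ Real.exp 2 * M ^ k := by
        gcongr
        rw [mul_one_div, div_le_iff₀ (by positivity)]
        linarith
    _ ≤ 8 * M ^ k := by gcongr

/-- The `k`-th derivative of `2 sin (x / 2) g(x)`, together with that of `sin (x / 2)`, is
dominated by `(n + 1 / 2) ^ k`. -/
lemma lower_order_lt {n : ℕ} {α : ℝ} (hα : α ∈ Set.Ioo (0 : ℝ) 1) (hαn : 2 ^ 29 ≤ α * n) {k : ℕ}
    (hk2 : k * α ≤ 2) (hk3 : 4 / 3 ≤ α * (k + 1)) :
    (1 / 2 : ℝ) ^ k + ((n : ℝ) ^ (1 - α) + 1) * (2 * ((n : ℝ) ^ (1 - α) + 1 / 2) ^ k) <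
      1 / 2 * ((n : ℝ) + 1 / 2) ^ k := by
  obtain ⟨h0, h1⟩ := hα
  have hn : (2 : ℝ) ^ 29 ≤ n := hαn.trans (mul_le_of_le_one_left n.cast_nonneg h1.le)
  have hn1 : (1 : ℝ) ≤ n := le_trans (by norm_num) hn
  have hn0 : (0 : ℝ) < n := by linarith
  set M := (n : ℝ) ^ (1 - α) with hMdef
  have hM : 1 ≤ M := Real.one_le_rpow hn1 (by linarith)
  have hnα : (n : ℝ) ^ α ≤ 2 * (α * n) := by
    have h := rpow_one_add_le_one_add_mul_self (s := (n : ℝ) - 1) (by linarith) h0.le h1.le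
    rw [add_sub_cancel] at h
    nlinarith
  have hαM : 1 ≤ 2 * (α * M) := by
    have h : M * (n : ℝ) ^ α = n := by rw [hMdef, ← Real.rpow_add hn0]; simp
    have h' : 1 * (n : ℝ) ≤ 2 * (α * M) * n := by
      calc 1 * (n : ℝ) = M * (n : ℝ) ^ α := by rw [h, one_mul]
        _ ≤ M * (2 * (α * n)) := by gcongr
        _ = 2 * (α * M) * n := by ring
    exact le_of_mul_le_mul_right h' hn0
  have hkM : (k : ℝ) ≤ 4 * M := by
    have : (k : ℝ) * α ≤ 4 * M * α := by linarith
    exact le_of_mul_le_mul_right this h0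
  have hpow : 66 * M ^ (k + 1) < (n : ℝ) ^ k := by
    have hMk : M ^ (k + 1) = (n : ℝ) ^ ((1 - α) * (k + 1)) := by
      rw [hMdef, ← Real.rpow_natCast, ← Real.rpow_mul hn0.le]; push_cast; rfl
    have hsplit : (n : ℝ) ^ k = (n : ℝ) ^ (α * (k + 1) - 1) * M ^ (k + 1) := by
      rw [hMk, ← Real.rpow_add hn0, ← Real.rpow_natCast]; congr 1; ring
    rw [hsplit]
    gcongr
    calc (66 : ℝ) < (2 ^ 9 : ℝ) := by norm_num
      _ = ((2 : ℝ) ^ (27 : ℕ)) ^ (1 / 3 : ℝ) := by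
        rw [← Real.rpow_natCast, ← Real.rpow_natCast, ← Real.rpow_mul (by norm_num)]; norm_num
      _ ≤ (n : ℝ) ^ (1 / 3 : ℝ) := by
        gcongr; exact le_trans (by norm_num) hn
      _ ≤ (n : ℝ) ^ (α * (k + 1) - 1) := Real.rpow_le_rpow_of_exponent_le hn1 (by linarith)
  have hMpow : 1 ≤ M ^ (k + 1) := one_le_pow₀ hM
  have hhalf : (1 / 2 : ℝ) ^ k ≤ 1 := pow_le_one₀ (by norm_num) (by norm_num)
  have hmain : (M + 1) * (2 * (M + 1 / 2) ^ k) ≤ 32 * M ^ (k + 1) := by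
    calc (M + 1) * (2 * (M + 1 / 2) ^ k) ≤ (M + M) * (2 * (8 * M ^ k)) := by
          gcongr; exact add_half_pow_le hM hkM
      _ = 32 * M ^ (k + 1) := by ring
  have hnk : (n : ℝ) ^ k ≤ ((n : ℝ) + 1 / 2) ^ k := by gcongr; linarith
  linarith

/-- `sin` and its derivative are not both small at nearby points. -/
lemma not_small_sin_and_sin_add_pi_div_two {u v : ℝ} (huv : |u - v| ≤ 1 / 8)
    (hu : |Real.sin u| < 1 / 2) (hv : |Real.sin (v + π / 2)| < 1 / 2) : False := by
  rw [Real.sin_add_pi_div_two] at hv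
  have hlip : |Real.sin v - Real.sin u| ≤ 1 / 8 := by
    have h : |Real.sin v - Real.sin u| ≤ |v - u| := by
      simpa [Real.dist_eq] using Real.lipschitzWith_sin.dist_le_mul v u
    exact h.trans (by rwa [abs_sub_comm])
  rw [abs_le] at hlip
  rw [abs_lt] at hu hv
  nlinarith [Real.sin_sq_add_cos_sq v]

/-- For `δ = 2⁻¹⁴` and `α ∈ (0,1)`: if `I = [a,b] ⊆ (2³¹(αn)⁻¹, π]` is an interval of
length `δ/n`, `g` is a `{0,1}`-cosine polynomial of degree at most `n^{1-α}`, and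
`f = D_n - g`, then `f` has at most `2α⁻¹` roots in `I`. -/
theorem stmt4 (n : ℕ) (δ α : ℝ) (hδ : δ = ((2 : ℝ) ^ (14 : ℕ))⁻¹)
    (hα : α ∈ Set.Ioo (0 : ℝ) 1)
    (ε : ℕ → ℝ) (hε : ∀ k, ε k = 0 ∨ ε k = 1)
    (hdeg : ∀ k : ℕ, (n : ℝ) ^ ((1 : ℝ) - α) < k → ε k = 0)
    (a b : ℝ) (ha : (2 : ℝ) ^ (31 : ℕ) / (α * n) < a) (hab : a ≤ b) (hb : b ≤ π)
    (hlen : b - a = δ / n) :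
    (zeros (fun x => Dker n x - ∑ k ∈ Finset.range (n + 1), ε k * Real.cos (k * x))
        (Set.Icc a b) : ℝ) ≤ 2 * α⁻¹ := by
  obtain ⟨h0, h1⟩ := hα
  by_contra! hcard
  rw [zeros] at hcard
  set Z := {x ∈ Set.Icc a b |
    Dker n x - ∑ k ∈ Finset.range (n + 1), ε k * Real.cos (k * x) = 0}
  have hinv : 2 < 2 * α⁻¹ := by
    have := one_lt_inv₀ h0 |>.2 h1
    linarith
  have hn0 : (0 : ℝ) < n := by
    rcases Nat.eq_zero_or_pos n with rfl | hn
    · have hab' : b = a := by simp at hlen; linarith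
      have hle : Z.ncard ≤ ({a} : Set ℝ).ncard :=
        Set.ncard_le_ncard (fun x hx => by simpa [hab'] using hx.1)
      rw [Set.ncard_singleton] at hle
      have : (Z.ncard : ℝ) ≤ 1 := by exact_mod_cast hle
      linarith
    · exact_mod_cast hn
  have hαn : 2 ^ 29 ≤ α * n := by
    have h : (2 : ℝ) ^ (31 : ℕ) / (α * n) < π := by linarith
    rw [div_lt_iff₀ (by positivity)] at h
    nlinarith [Real.pi_lt_four, mul_pos h0 hn0]
  have hn1 : (1 : ℝ) ≤ n := by nlinarith
  set q := ⌊2 * α⁻¹⌋₊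
  have hq : (q : ℝ) ≤ 2 * α⁻¹ := Nat.floor_le (by positivity)
  have hq' : 2 * α⁻¹ < q + 1 := Nat.lt_floor_add_one _
  have hq2 : 2 ≤ q := Nat.le_floor (by exact_mod_cast hinv.le)
  have hqα : q * α ≤ 2 := by
    calc q * α ≤ 2 * α⁻¹ * α := by gcongr
      _ = 2 := by field_simp
  have hqα' : 2 < (q + 1) * α := by
    calc 2 = 2 * α⁻¹ * α := by field_simp
      _ < (q + 1) * α := by gcongr
  have hq2' : (2 : ℝ) ≤ q := by exact_mod_cast hq2
  have hqα'' : 4 / 3 ≤ α * q := by nlinarith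
  have hZ : q + 1 ≤ Z.ncard := by
    have : (q : ℝ) < Z.ncard := hq.trans_lt hcard
    exact_mod_cast this
  obtain ⟨p, hp⟩ : ∃ p, q = p + 1 := ⟨q - 1, by omega⟩
  have hqp : (q : ℝ) = p + 1 := by rw [hp]; push_cast; rfl
  obtain ⟨S, hSZ, hS⟩ := Set.exists_subset_card_eq hZ
  have hSfin : S.Finite := Set.finite_of_ncard_pos (by omega)
  lift S to Finset ℝ using hSfin
  rw [Set.ncard_coe_finset] at hS
  set G : ℕ → ℝ → ℝ := fun k x =>
    sinDeriv (n + 1 / 2) k x + sinDeriv (1 / 2) k x - cosPolyDeriv n ε k x with hGdef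
  have hG : ∀ k x, HasDerivAt (G k) (G (k + 1) x) x := fun k x =>
    ((hasDerivAt_sinDeriv _ k x).add (hasDerivAt_sinDeriv _ k x)).sub
      (hasDerivAt_cosPolyDeriv n ε k x)
  have hSG : ∀ x ∈ S, x ∈ Set.Icc a b ∧ G 0 x = 0 := by
    intro x hx
    obtain ⟨hxI, hx0⟩ := hSZ hx
    refine ⟨hxI, ?_⟩
    have hcos : cosPolyDeriv n ε 0 x = 2 * Real.sin (x / 2) *
        ∑ k ∈ Finset.range (n + 1), ε k * Real.cos (k * x) := by
      rw [cosPolyDeriv, Finset.mul_sum]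
      refine Finset.sum_congr rfl fun j _ => ?_
      rw [← two_mul_sin_half_mul_cos]
      ring
    simp only [hGdef]
    rw [← two_mul_sin_half_mul_Dker, hcos, ← mul_sub, hx0, mul_zero]
  have hsmall : ∀ (k : ℕ) (x : ℝ), k * α ≤ 2 → 4 / 3 ≤ α * (k + 1) → G k x = 0 →
      |Real.sin (((n : ℝ) + 1 / 2) * x + k * (π / 2))| < 1 / 2 := by
    intro k x hk hk' hx
    have hw : 0 < ((n : ℝ) + 1 / 2) ^ k := by positivity
    have hlt : |sinDeriv (n + 1 / 2) k x| < 1 / 2 * ((n : ℝ) + 1 / 2) ^ k := by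
      have heq : sinDeriv (n + 1 / 2) k x = cosPolyDeriv n ε k x - sinDeriv (1 / 2) k x := by
        simp only [hGdef] at hx
        linarith
      have hhalf := abs_sinDeriv_le (w := 1 / 2) (abs_of_pos one_half_pos).le k x
      have hg := abs_cosPolyDeriv_le n hε (Real.rpow_nonneg hn0.le (1 - α)) hdeg k x
      have hlow := lower_order_lt ⟨h0, h1⟩ hαn hk hk'
      have habs := abs_sub (cosPolyDeriv n ε k x) (sinDeriv (1 / 2) k x)
      rw [heq]
      linarith
    rw [sinDeriv, abs_mul, abs_of_pos hw, mul_comm] at hlt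
    exact lt_of_mul_lt_mul_right hlt hw.le
  obtain ⟨y, hyI, hy⟩ := exists_zero_of_card_zeros hG S hS hSG
  obtain ⟨T, hTS, hT⟩ := Finset.exists_subset_card_eq (show p + 1 ≤ S.card by omega)
  obtain ⟨x, hxI, hx⟩ := exists_zero_of_card_zeros hG T hT fun z hz => hSG z (hTS hz)
  have hxs := hsmall p x (by nlinarith) (by rw [← hqp]; exact hqα'') hx
  have hys := hsmall q y hqα (by nlinarith) hy
  rw [hqp, add_one_mul, ← add_assoc] at hys
  refine not_small_sin_and_sin_add_pi_div_two ?_ hxs hys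
  have hxy : |x - y| ≤ δ / n := by
    rw [← hlen, abs_le]
    constructor <;> linarith [hxI.1, hxI.2, hyI.1, hyI.2]
  rw [add_sub_add_right_eq_sub, ← mul_sub, abs_mul, abs_of_pos (by positivity)]
  calc ((n : ℝ) + 1 / 2) * |x - y| ≤ (2 * n) * (δ / n) := by
        gcongr; linarith
    _ = 2 * δ := by field_simp
    _ ≤ 1 / 8 := by rw [hδ]; norm_num
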